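/- arXiv:0804.3600 — 9 statements merged into one kernel-verified Lean document; each statement's English description precedes it below -/
import Mathlib

section
/- Let α, β, γ be real numbers with β + γ ≠ 0 and α² + β² = γ². Then the solution set S = {x ∈ ℝ : α·sin x + β·cos x = γ} equals {x ∈ ℝ : ∃ k ∈ ℤ, x = 2kπ + 2θ}, where θ is the unique angle with −π/2 < θ < π/2 and tan θ = α/(β + γ) (i.e., θ = arctan(α/(β + γ))). -/
open Real

/-- The equation `α sin x + β cos x = γ` with `α² + β² = γ²` has a perfect square as its
half-angle form. -/
theorem mul_sin_add_mul_cos_eq_iff_half_angle {α β γ : ℝ} (hβγ : β + γ ≠ 0)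
    (h : α ^ 2 + β ^ 2 = γ ^ 2) (y : ℝ) :
    α * Real.sin (2 * y) + β * Real.cos (2 * y) = γ ↔
      (β + γ) * Real.sin y = α * Real.cos y := by
  have key : (β + γ) * (α * Real.sin (2 * y) + β * Real.cos (2 * y) - γ) =
      -((β + γ) * Real.sin y - α * Real.cos y) ^ 2 := by
    rw [Real.sin_two_mul, Real.cos_two_mul']
    linear_combination (Real.cos y) ^ 2 * h +
      (β + γ) * γ * Real.sin_sq_add_cos_sq y
  rw [← sub_eq_zero, ← mul_eq_zero_iff_left hβγ, key, neg_eq_zero,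
    sq_eq_zero_iff, sub_eq_zero]

/-- Angles on the line of slope `tan θ` through the origin differ from `θ` by multiples of `π`. -/
theorem mul_sin_eq_mul_cos_iff_exists_int {p q : ℝ} (hq : q ≠ 0) (y : ℝ) :
    q * Real.sin y = p * Real.cos y ↔ ∃ k : ℤ, y = k * π + Real.arctan (p / q) := by
  have hc : Real.cos (Real.arctan (p / q)) ≠ 0 := (Real.cos_arctan_pos _).ne'
  have hp : q * Real.sin (Real.arctan (p / q)) = p * Real.cos (Real.arctan (p / q)) := by
    rw [← Real.tan_mul_cos hc, Real.tan_arctan]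
    field_simp
  have key : q * Real.sin (y - Real.arctan (p / q)) =
      Real.cos (Real.arctan (p / q)) * (q * Real.sin y - p * Real.cos y) := by
    rw [Real.sin_sub]
    linear_combination -Real.cos y * hp
  have hsin : q * Real.sin y = p * Real.cos y ↔ Real.sin (y - Real.arctan (p / q)) = 0 := by
    rw [← sub_eq_zero, ← mul_eq_zero_iff_left hc, ← key, mul_eq_zero,
      or_iff_right hq]
  rw [hsin, Real.sin_eq_zero_iff]
  exact exists_congr fun k => by rw [eq_sub_iff_add_eq, eq_comm]

theorem stmt_5 (α β γ : ℝ) (hβγ : β + γ ≠ 0) (h : α ^ 2 + β ^ 2 = γ ^ 2) :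
    {x : ℝ | α * Real.sin x + β * Real.cos x = γ} =
      {x : ℝ | ∃ k : ℤ, x = 2 * (k : ℝ) * π + 2 * Real.arctan (α / (β + γ))} := by
  ext x
  obtain ⟨y, rfl⟩ : ∃ y, x = 2 * y := ⟨x / 2, by ring⟩
  rw [Set.mem_ofPred_eq, Set.mem_ofPred_eq, mul_sin_add_mul_cos_eq_iff_half_angle hβγ h,
    mul_sin_eq_mul_cos_iff_exists_int hβγ]
  refine exists_congr fun k => ?_
  rw [mul_assoc, ← mul_add, mul_right_inj' two_ne_zero]
end

section
/- Let α, β, γ be real numbers with β + γ ≠ 0 and α² + β² > γ². Then the solution set S = {x ∈ ℝ : α·sin x + β·cos x = γ} equals T₁ ∪ T₂, where for j = 1, 2, T_j = {x ∈ ℝ : ∃ k ∈ ℤ, x = 2kπ + 2θ_j}, θ_j = arctan(r_j), and r_j = (α + (−1)^{j+1}·√(α² + β² − γ²))/(β + γ). -/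
open Real

theorem exists_eq_two_mul_int_mul_pi_add_two_mul_arctan_iff (x r : ℝ) :
    (∃ k : ℤ, x = 2 * (k : ℝ) * π + 2 * arctan r) ↔ sin (x / 2) = r * cos (x / 2) := by
  have hsin : sin (x / 2 - arctan r) = cos (arctan r) * (sin (x / 2) - r * cos (x / 2)) := by
    have hr : r * cos (arctan r) = sin (arctan r) := by
      rw [cos_arctan, sin_arctan, mul_one_div]
    rw [sin_sub, ← hr]
    ring
  calc (∃ k : ℤ, x = 2 * (k : ℝ) * π + 2 * arctan r)
      ↔ ∃ k : ℤ, (k : ℝ) * π = x / 2 - arctan r :=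
        exists_congr fun k => ⟨fun h => by linarith, fun h => by linarith⟩
    _ ↔ sin (x / 2 - arctan r) = 0 := sin_eq_zero_iff.symm
    _ ↔ sin (x / 2) = r * cos (x / 2) := by
        rw [hsin, mul_eq_zero, or_iff_right (cos_arctan_pos r).ne', sub_eq_zero]

theorem stmt_6 (α β γ : ℝ) (hβγ : β + γ ≠ 0) (h : γ ^ 2 < α ^ 2 + β ^ 2)
    (r₁ r₂ θ₁ θ₂ : ℝ)
    (hr₁ : r₁ = (α + Real.sqrt (α ^ 2 + β ^ 2 - γ ^ 2)) / (β + γ))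
    (hr₂ : r₂ = (α - Real.sqrt (α ^ 2 + β ^ 2 - γ ^ 2)) / (β + γ))
    (hθ₁ : θ₁ = Real.arctan r₁) (hθ₂ : θ₂ = Real.arctan r₂) :
    {x : ℝ | α * Real.sin x + β * Real.cos x = γ} =
      {x : ℝ | ∃ k : ℤ, x = 2 * (k : ℝ) * π + 2 * θ₁} ∪
        {x : ℝ | ∃ k : ℤ, x = 2 * (k : ℝ) * π + 2 * θ₂} := by
  subst hθ₁ hθ₂
  have hsq : √(α ^ 2 + β ^ 2 - γ ^ 2) ^ 2 = α ^ 2 + β ^ 2 - γ ^ 2 := sq_sqrt (by linarith)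
  have hadd : (β + γ) * (r₁ + r₂) = 2 * α := by
    rw [hr₁, hr₂]
    field_simp
    ring
  have hmul : (β + γ) * (r₁ * r₂) = γ - β := by
    rw [hr₁, hr₂]
    field_simp
    linear_combination -hsq
  ext x
  simp only [Set.mem_union, Set.mem_ofPred_eq,
    exists_eq_two_mul_int_mul_pi_add_two_mul_arctan_iff]
  have hx : x = 2 * (x / 2) := by ring
  have hfactor : γ - (α * sin x + β * cos x) = (β + γ) *
      ((sin (x / 2) - r₁ * cos (x / 2)) * (sin (x / 2) - r₂ * cos (x / 2))) := by
    conv_lhs => rw [hx, sin_two_mul, cos_two_mul]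
    linear_combination (sin (x / 2) * cos (x / 2)) * hadd - cos (x / 2) ^ 2 * hmul
      - (β + γ) * sin_sq_add_cos_sq (x / 2)
  rw [eq_comm, ← sub_eq_zero, hfactor, mul_eq_zero, or_iff_right hβγ, mul_eq_zero, sub_eq_zero,
    sub_eq_zero]
end

section
/- Let α, β, γ be positive real numbers with α² + β² = γ². In the Euclidean plane ℝ², define the points Γ = (α²/γ, αβ/γ), B = (0, 0), Γ₁ = (β + γ, 0), Γ₂ = (0, −α). Then the four points Γ, B, Γ₁, Γ₂ are concyclic: each of them is at distance (1/2)·√(α² + (β + γ)²) from the midpoint ((β + γ)/2, −α/2) of the segment Γ₁Γ₂. In particular, Γ₁Γ₂ is a diameter of this circle. -/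
open Real

theorem EuclideanSpace.dist_eq_mul_sqrt {P Q : EuclideanSpace ℝ (Fin 2)} {c s : ℝ} (hc : 0 ≤ c)
    (h : (P 0 - Q 0) ^ 2 + (P 1 - Q 1) ^ 2 = c ^ 2 * s) : dist P Q = c * √s := by
  rw [EuclideanSpace.dist_eq, Fin.sum_univ_two, Real.dist_eq, Real.dist_eq, sq_abs, sq_abs, h,
    Real.sqrt_mul (sq_nonneg c), Real.sqrt_sq hc]

theorem stmt_9 (α β γ : ℝ) (hα : 0 < α) (hβ : 0 < β) (hγ : 0 < γ)
    (hpyth : α ^ 2 + β ^ 2 = γ ^ 2)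
    (Γ B Γ₁ Γ₂ M : EuclideanSpace ℝ (Fin 2))
    (hΓ : Γ 0 = α ^ 2 / γ ∧ Γ 1 = α * β / γ)
    (hB : B 0 = 0 ∧ B 1 = 0)
    (hΓ₁ : Γ₁ 0 = β + γ ∧ Γ₁ 1 = 0)
    (hΓ₂ : Γ₂ 0 = 0 ∧ Γ₂ 1 = -α)
    (hM : M 0 = (β + γ) / 2 ∧ M 1 = -α / 2) :
    M = midpoint ℝ Γ₁ Γ₂ ∧
      dist Γ M = (1 / 2) * Real.sqrt (α ^ 2 + (β + γ) ^ 2) ∧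
      dist B M = (1 / 2) * Real.sqrt (α ^ 2 + (β + γ) ^ 2) ∧
      dist Γ₁ M = (1 / 2) * Real.sqrt (α ^ 2 + (β + γ) ^ 2) ∧
      dist Γ₂ M = (1 / 2) * Real.sqrt (α ^ 2 + (β + γ) ^ 2) ∧
      dist Γ₁ Γ₂ = 2 * ((1 / 2) * Real.sqrt (α ^ 2 + (β + γ) ^ 2)) := by
  obtain ⟨hΓ0, hΓ1⟩ := hΓ
  obtain ⟨hB0, hB1⟩ := hB
  obtain ⟨hΓ₁0, hΓ₁1⟩ := hΓ₁
  obtain ⟨hΓ₂0, hΓ₂1⟩ := hΓ₂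
  obtain ⟨hM0, hM1⟩ := hM
  have hhalf : (0 : ℝ) ≤ 1 / 2 := by norm_num
  refine ⟨?_, EuclideanSpace.dist_eq_mul_sqrt hhalf ?_, EuclideanSpace.dist_eq_mul_sqrt hhalf ?_,
    EuclideanSpace.dist_eq_mul_sqrt hhalf ?_, EuclideanSpace.dist_eq_mul_sqrt hhalf ?_, ?_⟩
  · ext i
    fin_cases i
    · simp [midpoint_eq_smul_add, hM0, hΓ₁0, hΓ₂0]
      ring
    · simp [midpoint_eq_smul_add, hM1, hΓ₁1, hΓ₂1]
      ring
  · rw [hΓ0, hΓ1, hM0, hM1]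
    field_simp
    linear_combination 4 * α ^ 2 * hpyth
  · rw [hB0, hB1, hM0, hM1]
    ring
  · rw [hΓ₁0, hΓ₁1, hM0, hM1]
    ring
  · rw [hΓ₂0, hΓ₂1, hM0, hM1]
    ring
  · rw [← mul_assoc]
    apply EuclideanSpace.dist_eq_mul_sqrt (by norm_num)
    rw [hΓ₁0, hΓ₁1, hΓ₂0, hΓ₂1]
    ring
end

section
/- Let α, β, γ be positive real numbers with α² + β² = γ². In the Euclidean plane ℝ², define the points Γ = (α²/γ, αβ/γ), B = (0, 0), Γ₁ = (β + γ, 0), Γ₂ = (0, −α). Then the angle ∠Γ₂ Γ Γ₁ (the angle of the quadrilateral at the vertex Γ between the diagonal endpoint Γ₂ and the vertex Γ₁) measured at Γ in the triangle Γ₂ Γ Γ₁ is a right angle: ∠Γ₂ Γ Γ₁ = π/2, and likewise ∠Γ₂ B Γ₁ = π/2. -/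
open Real EuclideanGeometry

theorem stmt_10 (α β γ : ℝ) (hα : 0 < α) (hβ : 0 < β) (hγ : 0 < γ)
    (hpyth : α ^ 2 + β ^ 2 = γ ^ 2)
    (Γ B Γ₁ Γ₂ : EuclideanSpace ℝ (Fin 2))
    (hΓ : Γ 0 = α ^ 2 / γ ∧ Γ 1 = α * β / γ)
    (hB : B 0 = 0 ∧ B 1 = 0)
    (hΓ₁ : Γ₁ 0 = β + γ ∧ Γ₁ 1 = 0)
    (hΓ₂ : Γ₂ 0 = 0 ∧ Γ₂ 1 = -α) :
    ∠ Γ₂ Γ Γ₁ = π / 2 ∧ ∠ Γ₂ B Γ₁ = π / 2 := by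
  obtain ⟨hΓx, hΓy⟩ := hΓ
  obtain ⟨hBx, hBy⟩ := hB
  obtain ⟨hΓ₁x, hΓ₁y⟩ := hΓ₁
  obtain ⟨hΓ₂x, hΓ₂y⟩ := hΓ₂
  constructor <;>
    rw [EuclideanGeometry.angle, ← InnerProductGeometry.inner_eq_zero_iff_angle_eq_pi_div_two]
  · simp only [vsub_eq_sub, PiLp.inner_apply, Fin.sum_univ_two, PiLp.sub_apply, RCLike.inner_apply,
      conj_trivial, hΓx, hΓy, hΓ₁x, hΓ₁y, hΓ₂x, hΓ₂y]
    field_simp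
    linear_combination α ^ 2 * hpyth
  · simp [PiLp.inner_apply, Fin.sum_univ_two, hBx, hBy, hΓ₁x, hΓ₁y, hΓ₂x, hΓ₂y]
end

section
/- Let α, β, γ be positive real numbers with α² + β² = γ². In the Euclidean plane ℝ², define the points Γ = (α²/γ, αβ/γ), B = (0, 0), Γ₁ = (β + γ, 0), Γ₂ = (0, −α). Then the interior angles of the quadrilateral ΓBΓ₂Γ₁ are: ∠Γ B Γ₂ = π − arctan(α/β), ∠Γ Γ₁ Γ₂ = arctan(α/β), ∠Γ₁ Γ₂ B = arctan((β + γ)/α), and ∠B Γ Γ₁ = π − arctan((β + γ)/α). In particular, ∠Γ B Γ₂ + ∠Γ Γ₁ Γ₂ = π and ∠B Γ Γ₁ + ∠Γ₁ Γ₂ B = π. -/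
open Real EuclideanGeometry

theorem InnerProductGeometry.angle_eq_arctan {V : Type*} [NormedAddCommGroup V]
    [InnerProductSpace ℝ V] {x y : V} {t : ℝ} (ht : 0 ≤ t) (hxy : 0 < inner ℝ x y)
    (h : ‖x‖ ^ 2 * ‖y‖ ^ 2 = (1 + t ^ 2) * inner ℝ x y ^ 2) :
    InnerProductGeometry.angle x y = Real.arctan t := by
  have hnorm : ‖x‖ * ‖y‖ = √(1 + t ^ 2) * inner ℝ x y := by
    rw [← sq_eq_sq₀ (by positivity) (by positivity), mul_pow, mul_pow, h,
      Real.sq_sqrt (by positivity)]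
  rw [Real.arctan_eq_arccos ht, InnerProductGeometry.angle, hnorm, div_mul_cancel_right₀ hxy.ne']

theorem EuclideanGeometry.angle_eq_arctan_of_cross {P Q R : EuclideanSpace ℝ (Fin 2)} {p q : ℝ}
    (hp : 0 ≤ p) (hq : 0 < q)
    (hinner : 0 < (P 0 - Q 0) * (R 0 - Q 0) + (P 1 - Q 1) * (R 1 - Q 1))
    (hcross : q * |(P 0 - Q 0) * (R 1 - Q 1) - (P 1 - Q 1) * (R 0 - Q 0)| =
      p * ((P 0 - Q 0) * (R 0 - Q 0) + (P 1 - Q 1) * (R 1 - Q 1))) :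
    ∠ P Q R = Real.arctan (p / q) := by
  have hin : inner ℝ (P -ᵥ Q) (R -ᵥ Q) =
      (P 0 - Q 0) * (R 0 - Q 0) + (P 1 - Q 1) * (R 1 - Q 1) := by
    simp [PiLp.inner_apply, Fin.sum_univ_two]
    ring
  refine InnerProductGeometry.angle_eq_arctan (by positivity) (hin ▸ hinner) ?_
  have hsq := congrArg (· ^ 2) hcross
  simp only [mul_pow, sq_abs] at hsq
  rw [hin, EuclideanSpace.real_norm_sq_eq, EuclideanSpace.real_norm_sq_eq]
  simp only [Fin.sum_univ_two, vsub_eq_sub, PiLp.sub_apply]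
  field_simp
  linear_combination hsq

theorem EuclideanGeometry.angle_eq_pi_sub_arctan_of_cross {P Q R : EuclideanSpace ℝ (Fin 2)}
    {p q : ℝ} (hp : 0 ≤ p) (hq : 0 < q)
    (hinner : (P 0 - Q 0) * (R 0 - Q 0) + (P 1 - Q 1) * (R 1 - Q 1) < 0)
    (hcross : q * |(P 0 - Q 0) * (R 1 - Q 1) - (P 1 - Q 1) * (R 0 - Q 0)| =
      -(p * ((P 0 - Q 0) * (R 0 - Q 0) + (P 1 - Q 1) * (R 1 - Q 1)))) :
    ∠ P Q R = π - Real.arctan (p / q) := by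
  have hreflect : ∠ P Q R = π - ∠ P Q (Q + Q - R) := by
    have hneg : Q + Q - R -ᵥ Q = -(R -ᵥ Q) := by simp only [vsub_eq_sub]; abel
    rw [EuclideanGeometry.angle, EuclideanGeometry.angle, hneg,
      InnerProductGeometry.angle_neg_right]
    ring
  rw [hreflect, angle_eq_arctan_of_cross hp hq]
  · simp only [PiLp.sub_apply, PiLp.add_apply]
    linarith
  · simp only [PiLp.sub_apply, PiLp.add_apply]
    rw [← abs_neg]
    convert hcross using 1 <;> ring_nf

theorem stmt_11 (α β γ : ℝ) (hα : 0 < α) (hβ : 0 < β) (hγ : 0 < γ)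
    (hpyth : α ^ 2 + β ^ 2 = γ ^ 2)
    (Γ B Γ₁ Γ₂ : EuclideanSpace ℝ (Fin 2))
    (hΓ : Γ 0 = α ^ 2 / γ ∧ Γ 1 = α * β / γ)
    (hB : B 0 = 0 ∧ B 1 = 0)
    (hΓ₁ : Γ₁ 0 = β + γ ∧ Γ₁ 1 = 0)
    (hΓ₂ : Γ₂ 0 = 0 ∧ Γ₂ 1 = -α) :
    ∠ Γ B Γ₂ = π - Real.arctan (α / β) ∧
      ∠ Γ Γ₁ Γ₂ = Real.arctan (α / β) ∧
      ∠ Γ₁ Γ₂ B = Real.arctan ((β + γ) / α) ∧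
      ∠ B Γ Γ₁ = π - Real.arctan ((β + γ) / α) ∧
      ∠ Γ B Γ₂ + ∠ Γ Γ₁ Γ₂ = π ∧
      ∠ B Γ Γ₁ + ∠ Γ₁ Γ₂ B = π := by
  obtain ⟨hΓx, hΓy⟩ := hΓ
  obtain ⟨hBx, hBy⟩ := hB
  obtain ⟨hΓ₁x, hΓ₁y⟩ := hΓ₁
  obtain ⟨hΓ₂x, hΓ₂y⟩ := hΓ₂
  have hΓΓ₁x : Γ 0 - Γ₁ 0 = -(β / γ * (β + γ)) := by
    rw [hΓx, hΓ₁x]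
    field_simp
    linear_combination hpyth
  have hΓΓ₁y : Γ 1 - Γ₁ 1 = β / γ * α := by
    rw [hΓy, hΓ₁y]
    ring
  have hΓ₁Γx : Γ₁ 0 - Γ 0 = β / γ * (β + γ) := by linarith
  have hΓ₁Γy : Γ₁ 1 - Γ 1 = -(β / γ * α) := by linarith
  have angle_B : ∠ Γ B Γ₂ = π - Real.arctan (α / β) := by
    apply angle_eq_pi_sub_arctan_of_cross hα.le hβ
    · rw [hΓx, hΓy, hBx, hBy, hΓ₂x, hΓ₂y]
      have : 0 < α * β / γ * α := by positivity
      linarith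
    · rw [hΓx, hΓy, hBx, hBy, hΓ₂x, hΓ₂y, abs_of_nonpos]
      · ring
      · have : 0 < α ^ 2 / γ * α := by positivity
        linarith
  have angle_Γ₁ : ∠ Γ Γ₁ Γ₂ = Real.arctan (α / β) := by
    apply angle_eq_arctan_of_cross hα.le hβ
    · rw [hΓΓ₁x, hΓΓ₁y, hΓ₁x, hΓ₁y, hΓ₂x, hΓ₂y]
      have : 0 < β / γ * (2 * β * (β + γ)) := by positivity
      linear_combination this + β / γ * hpyth
    · rw [hΓΓ₁x, hΓΓ₁y, hΓ₁x, hΓ₁y, hΓ₂x, hΓ₂y, abs_of_nonneg]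
      · linear_combination β / γ * α * hpyth
      · have : 0 < β / γ * (2 * α * (β + γ)) := by positivity
        linarith
  have angle_Γ₂ : ∠ Γ₁ Γ₂ B = Real.arctan ((β + γ) / α) := by
    apply angle_eq_arctan_of_cross (by positivity) hα
    · rw [hΓ₁x, hΓ₁y, hBx, hBy, hΓ₂x, hΓ₂y]
      nlinarith
    · rw [hΓ₁x, hΓ₁y, hBx, hBy, hΓ₂x, hΓ₂y, abs_of_nonneg]
      · ring
      · have : 0 < (β + γ) * α := by positivity
        linarith
  have angle_Γ : ∠ B Γ Γ₁ = π - Real.arctan ((β + γ) / α) := by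
    apply angle_eq_pi_sub_arctan_of_cross (by positivity) hα
    · rw [hΓ₁Γx, hΓ₁Γy, hBx, hBy, hΓx, hΓy]
      have : 0 < α ^ 2 / γ * (β / γ) * γ := by positivity
      linear_combination this
    · rw [hΓ₁Γx, hΓ₁Γy, hBx, hBy, hΓx, hΓy, abs_of_nonneg]
      · linear_combination α ^ 2 / γ * (β / γ) * hpyth
      · have : 0 < α / γ * (β / γ) * (α ^ 2 + β * (β + γ)) := by positivity
        linear_combination this
  refine ⟨angle_B, angle_Γ₁, angle_Γ₂, angle_Γ, ?_, ?_⟩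
  · rw [angle_B, angle_Γ₁]
    ring
  · rw [angle_Γ, angle_Γ₂]
    ring
end

section
/- Let α, β, γ be positive real numbers with α² + β² = γ². In the Euclidean plane ℝ², define the points Γ = (α²/γ, αβ/γ), B = (0, 0), Γ₁ = (β + γ, 0), Γ₂ = (0, −α). Then the three angles φ = ∠B Γ Γ₂, ω = ∠Γ Γ₁ B, and θ = ∠B Γ₁ Γ₂ are all equal, and their common value is arctan(α/(β + γ)). -/
open Real EuclideanGeometry

theorem EuclideanGeometry.angle_eq_arctan_of_coords {P Q R : EuclideanSpace ℝ (Fin 2)} {t : ℝ}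
    (ht : 0 ≤ t)
    (hdot : 0 < (P 0 - Q 0) * (R 0 - Q 0) + (P 1 - Q 1) * (R 1 - Q 1))
    (hcross : ((P 0 - Q 0) * (R 1 - Q 1) - (P 1 - Q 1) * (R 0 - Q 0)) ^ 2 =
      (t * ((P 0 - Q 0) * (R 0 - Q 0) + (P 1 - Q 1) * (R 1 - Q 1))) ^ 2) :
    ∠ P Q R = Real.arctan t := by
  have hinner : inner ℝ (P -ᵥ Q) (R -ᵥ Q) =
      (P 0 - Q 0) * (R 0 - Q 0) + (P 1 - Q 1) * (R 1 - Q 1) := by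
    simp [PiLp.inner_apply, Fin.sum_univ_two, mul_comm]
  refine InnerProductGeometry.angle_eq_arctan ht (hinner ▸ hdot) ?_
  rw [hinner, EuclideanSpace.real_norm_sq_eq, EuclideanSpace.real_norm_sq_eq]
  simp only [Fin.sum_univ_two, vsub_eq_sub, PiLp.sub_apply]
  linear_combination hcross

theorem stmt_12 (α β γ : ℝ) (hα : 0 < α) (hβ : 0 < β) (hγ : 0 < γ)
    (hpyth : α ^ 2 + β ^ 2 = γ ^ 2)
    (Γ B Γ₁ Γ₂ : EuclideanSpace ℝ (Fin 2))
    (hΓ : Γ 0 = α ^ 2 / γ ∧ Γ 1 = α * β / γ)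
    (hB : B 0 = 0 ∧ B 1 = 0)
    (hΓ₁ : Γ₁ 0 = β + γ ∧ Γ₁ 1 = 0)
    (hΓ₂ : Γ₂ 0 = 0 ∧ Γ₂ 1 = -α) :
    ∠ B Γ Γ₂ = Real.arctan (α / (β + γ)) ∧
      ∠ Γ Γ₁ B = Real.arctan (α / (β + γ)) ∧
      ∠ B Γ₁ Γ₂ = Real.arctan (α / (β + γ)) := by
  obtain ⟨hΓx, hΓy⟩ := hΓ
  obtain ⟨hBx, hBy⟩ := hB
  obtain ⟨hΓ₁x, hΓ₁y⟩ := hΓ₁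
  obtain ⟨hΓ₂x, hΓ₂y⟩ := hΓ₂
  have ht : 0 ≤ α / (β + γ) := by positivity
  refine ⟨angle_eq_arctan_of_coords ht ?_ ?_, angle_eq_arctan_of_coords ht ?_ ?_,
    angle_eq_arctan_of_coords ht ?_ ?_⟩ <;>
    simp only [hΓx, hΓy, hBx, hBy, hΓ₁x, hΓ₁y, hΓ₂x, hΓ₂y]
  · ring_nf
    positivity
  · have hdot : (0 - α ^ 2 / γ) * (0 - α ^ 2 / γ) + (0 - α * β / γ) * (-α - α * β / γ) =
        α ^ 2 * (β + γ) / γ := by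
      field_simp
      linear_combination α ^ 2 * hpyth
    rw [hdot]
    field_simp
    ring
  · have hx : α ^ 2 / γ - (β + γ) = -(β * (β + γ) / γ) := by
      field_simp
      linear_combination hpyth
    rw [hx]
    ring_nf
    positivity
  · have hx : α ^ 2 / γ - (β + γ) = -(β * (β + γ) / γ) := by
      field_simp
      linear_combination hpyth
    rw [hx]
    field_simp
    ring
  · ring_nf
    positivity
  · field_simp
    ring
end

section
/- Let α, β, γ be positive real numbers with α² + β² = γ². In the Euclidean plane ℝ², define the points Γ = (α²/γ, αβ/γ), B = (0, 0), Γ₁ = (β + γ, 0), Γ₂ = (0, −α). Then the area (two-dimensional Lebesgue measure) of the convex hull of {Γ, B, Γ₂, Γ₁} equals α·(β + γ)²/(2γ). -/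
open Real MeasureTheory

/-- The convex hull of a triangle-split quadrilateral with diagonal on the first axis, as an
intersection of four half-planes. -/
theorem convexHull_quadrilateral_eq {p h L k : ℝ} (hp : 0 < p) (hh : 0 < h) (hpL : p < L)
    (hk : 0 < k) (P O Q R : EuclideanSpace ℝ (Fin 2))
    (hP : P 0 = p ∧ P 1 = h) (hO : O 0 = 0 ∧ O 1 = 0) (hQ : Q 0 = L ∧ Q 1 = 0)
    (hR : R 0 = 0 ∧ R 1 = -k) :
    convexHull ℝ {P, O, R, Q} = {z : EuclideanSpace ℝ (Fin 2) |
      max 0 (p * z 1 / h) ≤ z 0 ∧ z 0 ≤ min (L * (1 + z 1 / k)) (L - z 1 * (L - p) / h)} := by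
  obtain ⟨hP0, hP1⟩ := hP
  obtain ⟨hO0, hO1⟩ := hO
  obtain ⟨hQ0, hQ1⟩ := hQ
  obtain ⟨hR0, hR1⟩ := hR
  have hL : 0 < L := hp.trans hpL
  apply Set.Subset.antisymm
  · apply convexHull_min
    · rintro z (rfl | rfl | rfl | rfl)
      · simp only [Set.mem_ofPred_eq, hP0, hP1, max_le_iff, le_min_iff]
        refine ⟨⟨hp.le, by field_simp; rfl⟩, ?_, by field_simp; linarith⟩
        have : 0 < h / k := by positivity
        nlinarith
      · simp [hO0, hO1, hL.le]
      · simp only [Set.mem_ofPred_eq, hR0, hR1, max_le_iff, le_min_iff]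
        refine ⟨⟨le_rfl, ?_⟩, by field_simp; simp, ?_⟩
        · have : 0 < p * k / h := by positivity
          have e : p * -k / h = -(p * k / h) := by ring
          linarith
        · have : 0 < k * (L - p) / h := div_pos (mul_pos hk (sub_pos.2 hpL)) hh
          have e : -k * (L - p) / h = -(k * (L - p) / h) := by ring
          linarith
      · simp [hQ0, hQ1, hL.le]
    · intro u hu v hv a b ha hb hab
      obtain rfl : b = 1 - a := by linarith
      simp only [Set.mem_ofPred_eq, max_le_iff, le_min_iff, PiLp.add_apply, PiLp.smul_apply,
        smul_eq_mul] at hu hv ⊢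
      obtain ⟨⟨u1, u2⟩, u3, u4⟩ := hu
      obtain ⟨⟨v1, v2⟩, v3, v4⟩ := hv
      refine ⟨⟨by positivity, ?_⟩, ?_, ?_⟩
      · linear_combination a * u2 + (1 - a) * v2
      · linear_combination a * u3 + (1 - a) * v3
      · linear_combination a * u4 + (1 - a) * v4
  · rintro z ⟨h1, h2⟩
    obtain ⟨h1, h2'⟩ := max_le_iff.1 h1
    obtain ⟨h3, h4⟩ := le_min_iff.1 h2
    have key : ∀ A ∈ ({P, O, R, Q} : Set (EuclideanSpace ℝ (Fin 2))), ∀ a b : ℝ, 0 ≤ a → 0 ≤ b →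
        a + b ≤ 1 → z 0 = a * A 0 + b * L → z 1 = a * A 1 →
        z ∈ convexHull ℝ {P, O, R, Q} := by
      intro A hA a b ha hb hab e0 e1
      have hz : z = ∑ i, (![a, b, 1 - a - b] i) • (![A, Q, O] i) := by
        ext i
        fin_cases i <;> simp [Fin.sum_univ_three, e0, e1, hQ0, hQ1, hO0, hO1]
      rw [hz]
      refine (convex_convexHull ℝ _).sum_mem ?_ ?_ ?_
      · intro i _
        fin_cases i
        · exact ha
        · exact hb
        · change 0 ≤ 1 - a - b
          linarith
      · simp [Fin.sum_univ_three]
      · intro i _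
        apply subset_convexHull
        fin_cases i
        · exact hA
        · simp
        · simp
    rcases le_total 0 (z 1) with hy | hy
    · refine key P (by simp) (z 1 / h) ((z 0 - p * z 1 / h) / L) (by positivity)
        (div_nonneg (sub_nonneg.2 h2') hL.le) ?_ ?_ ?_
      · have : (z 0 - p * z 1 / h) / L ≤ 1 - z 1 / h := by
          rw [div_le_iff₀ hL]
          linear_combination h4
        linarith
      · rw [hP0]
        field_simp
        ring
      · rw [hP1]
        field_simp
    · refine key R (by simp) (-z 1 / k) (z 0 / L) (div_nonneg (neg_nonneg.2 hy) hk.le)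
        (by positivity) ?_ ?_ ?_
      · have : z 0 / L ≤ 1 + z 1 / k := by
          rw [div_le_iff₀ hL]
          linear_combination h3
        linear_combination this
      · rw [hR0]
        field_simp
        ring
      · rw [hR1]
        field_simp

/-- The area of a planar region whose horizontal slices are closed intervals. -/
theorem volume_setOf_horizontal_slices {f g : ℝ → ℝ} (hf : Continuous f) (hg : Continuous g) :
    volume {z : EuclideanSpace ℝ (Fin 2) | f (z 1) ≤ z 0 ∧ z 0 ≤ g (z 1)} =
      ∫⁻ y, ENNReal.ofReal (g y - f y) := by
  have hS : MeasurableSet {z : ℝ × ℝ | f z.2 ≤ z.1 ∧ z.1 ≤ g z.2} := by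
    rw [Set.ofPred_and]
    exact (measurableSet_le (by fun_prop) (by fun_prop)).inter
      (measurableSet_le (by fun_prop) (by fun_prop))
  have hpres := (volume_preserving_finTwoArrow ℝ).comp
    (EuclideanSpace.volume_preserving_symm_measurableEquiv_toLp (Fin 2))
  have := hpres.measure_preimage hS.nullMeasurableSet
  refine (Eq.trans ?_ this).trans ?_
  · rfl
  · rw [Measure.volume_eq_prod, Measure.prod_apply_symm hS]
    refine lintegral_congr fun y => ?_
    have hslice : (fun x => (x, y)) ⁻¹' {z : ℝ × ℝ | f z.2 ≤ z.1 ∧ z.1 ≤ g z.2} =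
        Set.Icc (f y) (g y) := by
      ext x
      simp
    rw [hslice, Real.volume_Icc]

/-- The area under a tent of height `L` over `[-k, h]`. -/
theorem lintegral_ofReal_tent {L h k : ℝ} (hL : 0 < L) (hh : 0 < h) (hk : 0 < k) :
    ∫⁻ y, ENNReal.ofReal (min (L * (1 + y / k)) (L * (1 - y / h))) =
      ENNReal.ofReal (L * (h + k) / 2) := by
  set F : ℝ → ℝ := fun y => min (L * (1 + y / k)) (L * (1 - y / h)) with hF
  have hFc : Continuous F := by fun_prop
  have hind : (fun y => ENNReal.ofReal (F y)) =
      (Set.Icc (-k) h).indicator fun y => ENNReal.ofReal (F y) := by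
    funext y
    by_cases hy : y ∈ Set.Icc (-k) h
    · rw [Set.indicator_of_mem hy]
    · rw [Set.indicator_of_notMem hy, ENNReal.ofReal_eq_zero]
      rcases lt_or_ge y (-k) with h1 | h1
      · refine (min_le_left _ _).trans (mul_nonpos_of_nonneg_of_nonpos hL.le ?_)
        have : y / k ≤ -1 := by
          rw [div_le_iff₀ hk]
          linarith
        linarith
      · have h2 : h < y := not_le.1 fun h2 => hy ⟨h1, h2⟩
        refine (min_le_right _ _).trans (mul_nonpos_of_nonneg_of_nonpos hL.le ?_)
        have : 1 ≤ y / h := by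
          rw [le_div_iff₀ hh]
          linarith
        linarith
  have hleft : ∫ y in (-k)..0, F y = L * k / 2 := by
    have : ∫ y in (-k)..0, F y = ∫ y in (-k)..0, L * (1 + y / k) := by
      refine intervalIntegral.integral_congr fun y hy => ?_
      rw [Set.uIcc_of_le (by linarith)] at hy
      refine min_eq_left (mul_le_mul_of_nonneg_left ?_ hL.le)
      have h1 : y / k ≤ 0 := div_nonpos_of_nonpos_of_nonneg hy.2 hk.le
      have h2 : y / h ≤ 0 := div_nonpos_of_nonpos_of_nonneg hy.2 hh.le
      linarith
    rw [this, intervalIntegral.integral_const_mul, intervalIntegral.integral_add (by simp)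
      (Continuous.intervalIntegrable (by fun_prop) _ _), intervalIntegral.integral_div]
    simp
    field_simp
    ring
  have hright : ∫ y in (0 : ℝ)..h, F y = L * h / 2 := by
    have : ∫ y in (0 : ℝ)..h, F y = ∫ y in (0 : ℝ)..h, L * (1 - y / h) := by
      refine intervalIntegral.integral_congr fun y hy => ?_
      rw [Set.uIcc_of_le hh.le] at hy
      refine min_eq_right (mul_le_mul_of_nonneg_left ?_ hL.le)
      have h1 : 0 ≤ y / k := div_nonneg hy.1 hk.le
      have h2 : 0 ≤ y / h := div_nonneg hy.1 hh.le
      linarith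
    rw [this, intervalIntegral.integral_const_mul, intervalIntegral.integral_sub (by simp)
      (Continuous.intervalIntegrable (by fun_prop) _ _), intervalIntegral.integral_div]
    simp
    field_simp
    ring
  rw [hind, lintegral_indicator measurableSet_Icc, ← ofReal_integral_eq_lintegral_ofReal
    hFc.continuousOn.integrableOn_Icc, integral_Icc_eq_integral_Ioc,
    ← intervalIntegral.integral_of_le (by linarith),
    ← intervalIntegral.integral_add_adjacent_intervals (hFc.intervalIntegrable (-k) 0)
      (hFc.intervalIntegrable 0 h), hleft, hright]
  · congr 1
    ring
  · refine (ae_restrict_iff' measurableSet_Icc).2 (.of_forall fun y hy => ?_)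
    refine le_min (mul_nonneg hL.le ?_) (mul_nonneg hL.le ?_)
    · have : -1 ≤ y / k := by
        rw [le_div_iff₀ hk]
        linarith [hy.1]
      linarith
    · have : y / h ≤ 1 := by
        rw [div_le_iff₀ hh]
        linarith [hy.2]
      linarith

theorem stmt_13 (α β γ : ℝ) (hα : 0 < α) (hβ : 0 < β) (hγ : 0 < γ)
    (hpyth : α ^ 2 + β ^ 2 = γ ^ 2)
    (Γ B Γ₁ Γ₂ : EuclideanSpace ℝ (Fin 2))
    (hΓ : Γ 0 = α ^ 2 / γ ∧ Γ 1 = α * β / γ)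
    (hB : B 0 = 0 ∧ B 1 = 0)
    (hΓ₁ : Γ₁ 0 = β + γ ∧ Γ₁ 1 = 0)
    (hΓ₂ : Γ₂ 0 = 0 ∧ Γ₂ 1 = -α) :
    volume (convexHull ℝ {Γ, B, Γ₂, Γ₁}) =
      ENNReal.ofReal (α * (β + γ) ^ 2 / (2 * γ)) := by
  have hp : 0 < α ^ 2 / γ := by positivity
  have hh : 0 < α * β / γ := by positivity
  have hL : 0 < β + γ := by positivity
  have hpL : α ^ 2 / γ < β + γ := by
    rw [div_lt_iff₀ hγ]
    nlinarith [mul_pos hβ hγ, sq_nonneg β]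
  rw [convexHull_quadrilateral_eq hp hh hpL hα Γ B Γ₁ Γ₂ hΓ hB hΓ₁ hΓ₂]
  generalize hpd : α ^ 2 / γ = p at *
  generalize hhd : α * β / γ = h at *
  generalize hLd : β + γ = L at *
  rw [volume_setOf_horizontal_slices (f := fun y => max 0 (p * y / h))
    (g := fun y => min (L * (1 + y / α)) (L - y * (L - p) / h)) (by fun_prop) (by fun_prop)]
  have harea : α * L ^ 2 / (2 * γ) = L * (h + α) / 2 := by
    rw [← hhd, ← hLd]
    field_simp
  rw [harea, ← lintegral_ofReal_tent hL hh hα]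
  refine lintegral_congr fun y => congrArg ENNReal.ofReal ?_
  have e : L - y * (L - p) / h = L * (1 - y / h) + p * y / h := by ring
  rcases le_total 0 y with hy | hy
  · have h1 : 0 ≤ y / α := by positivity
    have h2 : 0 ≤ y / h := by positivity
    have h3 : y * (L - p) / h ≥ 0 := div_nonneg (mul_nonneg hy (sub_nonneg.2 hpL.le)) hh.le
    rw [max_eq_right (by positivity), min_eq_right (by nlinarith), min_eq_right (by nlinarith), e]
    ring
  · have h1 : y / α ≤ 0 := div_nonpos_of_nonpos_of_nonneg hy hα.le
    have h2 : y / h ≤ 0 := div_nonpos_of_nonpos_of_nonneg hy hh.le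
    have h3 : y * (L - p) / h ≤ 0 :=
      div_nonpos_of_nonpos_of_nonneg (mul_nonpos_of_nonpos_of_nonneg hy (sub_nonneg.2 hpL.le)) hh.le
    have h4 : p * y / h ≤ 0 :=
      div_nonpos_of_nonpos_of_nonneg (mul_nonpos_of_nonneg_of_nonpos hp.le hy) hh.le
    rw [max_eq_left h4, min_eq_left (by nlinarith), min_eq_left (by nlinarith)]
    ring
end

section
/- Let δ, m, n, L be positive integers with m > n, gcd(m, n) = 1, m + n odd, and m² + n² = L². Then the rational number x = 2·δ·m·(m² − n²)/L is an integer if and only if L divides δ; equivalently, L divides 2·δ·m·(m² − n²) if and only if L divides δ. Likewise, the rational number y = 4·δ·m²·n/L is an integer if and only if L divides δ. -/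
theorem exists_int_eq_natCast_div_iff_dvd {a L : ℕ} (hL : 0 < L) :
    (∃ z : ℤ, (a : ℚ) / (L : ℚ) = (z : ℚ)) ↔ L ∣ a := by
  have hL' : (L : ℚ) ≠ 0 := by exact_mod_cast hL.ne'
  constructor
  · rintro ⟨z, hz⟩
    rw [div_eq_iff hL'] at hz
    have h : (a : ℤ) = z * L := by exact_mod_cast hz
    exact Int.natCast_dvd_natCast.mp ⟨z, by rw [h, mul_comm]⟩
  · rintro ⟨k, rfl⟩
    refine ⟨k, ?_⟩
    push_cast
    field_simp

theorem coprime_left_of_sq_add_sq_eq_sq {m n L : ℕ} (hcop : Nat.Coprime m n)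
    (hpyth : m ^ 2 + n ^ 2 = L ^ 2) : Nat.Coprime L m := by
  have h : Nat.Coprime (m ^ 2 + n ^ 2) (m ^ 2) := by
    exact Nat.coprime_self_add_left.mpr (hcop.pow 2 2).symm
  rw [hpyth] at h
  exact (Nat.coprime_pow_left_iff two_pos _ _).mp
    ((Nat.coprime_pow_right_iff two_pos _ _).mp h)

theorem coprime_two_of_sq_add_sq_eq_sq {m n L : ℕ} (hpar : (m + n) % 2 = 1)
    (hpyth : m ^ 2 + n ^ 2 = L ^ 2) : Nat.Coprime L 2 := by
  have h : Odd (m ^ 2 + n ^ 2) := by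
    have := Nat.odd_iff.mpr hpar
    simpa [Nat.odd_add, Nat.odd_pow_iff, Nat.even_pow] using this
  rw [hpyth, Nat.odd_pow_iff two_ne_zero] at h
  exact Nat.coprime_two_right.mpr h

theorem coprime_sq_sub_sq_of_sq_add_sq_eq_sq {m n L : ℕ} (hmn : n ≤ m)
    (hm : Nat.Coprime L m) (h2 : Nat.Coprime L 2) (hpyth : m ^ 2 + n ^ 2 = L ^ 2) :
    Nat.Coprime L (m ^ 2 - n ^ 2) := by
  have hle : n ^ 2 ≤ m ^ 2 := Nat.pow_le_pow_left hmn 2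
  have hsum : 2 * m ^ 2 = L ^ 2 + (m ^ 2 - n ^ 2) := by omega
  have h : Nat.Coprime L (2 * m ^ 2) := h2.mul_right (hm.pow_right 2)
  rw [hsum, sq L] at h
  simpa using h

theorem stmt_16 (δ m n L : ℕ) (hδ : 0 < δ) (hm : 0 < m) (hn : 0 < n) (hL : 0 < L)
    (hmn : n < m) (hcop : Nat.gcd m n = 1) (hpar : (m + n) % 2 = 1)
    (hpyth : m ^ 2 + n ^ 2 = L ^ 2) :
    ((∃ z : ℤ, ((2 * δ * m * (m ^ 2 - n ^ 2) : ℕ) : ℚ) / (L : ℚ) = (z : ℚ)) ↔ L ∣ δ) ∧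
      (L ∣ 2 * δ * m * (m ^ 2 - n ^ 2) ↔ L ∣ δ) ∧
      ((∃ z : ℤ, ((4 * δ * m ^ 2 * n : ℕ) : ℚ) / (L : ℚ) = (z : ℚ)) ↔ L ∣ δ) ∧
      (L ∣ 4 * δ * m ^ 2 * n ↔ L ∣ δ) := by
  have hLm : Nat.Coprime L m := coprime_left_of_sq_add_sq_eq_sq hcop hpyth
  have hLn : Nat.Coprime L n :=
    coprime_left_of_sq_add_sq_eq_sq (Nat.Coprime.symm hcop) (by rw [add_comm, hpyth])
  have hL2 : Nat.Coprime L 2 := coprime_two_of_sq_add_sq_eq_sq hpar hpyth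
  have hLd : Nat.Coprime L (m ^ 2 - n ^ 2) :=
    coprime_sq_sub_sq_of_sq_add_sq_eq_sq hmn.le hLm hL2 hpyth
  have hx : L ∣ 2 * δ * m * (m ^ 2 - n ^ 2) ↔ L ∣ δ := by
    rw [hLd.dvd_mul_right, hLm.dvd_mul_right, hL2.dvd_mul_left]
  have hy : L ∣ 4 * δ * m ^ 2 * n ↔ L ∣ δ := by
    rw [hLn.dvd_mul_right, (hLm.pow_right 2).dvd_mul_right,
      Nat.Coprime.dvd_mul_left (hL2.pow_right 2 : Nat.Coprime L 4)]
  exact ⟨(exists_int_eq_natCast_div_iff_dvd hL).trans hx, hx,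
    (exists_int_eq_natCast_div_iff_dvd hL).trans hy, hy⟩
end

section
/- Let m, n, L, δ be positive integers with m > n, gcd(m, n) = 1, m + n odd, m² + n² = L², and suppose L divides δ. Then all six lengths of the quadrilateral ΓBΓ₂Γ₁ of family F₁ are integers: |ΓB| = |BΓ₂| = 2δmn, |Γ₂Γ₁| = 2δmL, |BΓ₁| = 2δm², and the rational numbers x = 2δm(m² − n²)/L and y = 4δm²n/L are integers; moreover the area A = δ²·m·n·((m² − n²) + (m² − n²)²/(m² + n²) + 2m²) is an integer. Hence the quadrilateral is a Heron quadrilateral (integer sides, integer diagonals, integer area). -/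
theorem stmt_18 (δ m n L : ℕ) (hδpos : 0 < δ) (hm : 0 < m) (hn : 0 < n) (hL : 0 < L)
    (hmn : n < m) (hcop : Nat.gcd m n = 1) (hpar : (m + n) % 2 = 1)
    (hpyth : m ^ 2 + n ^ 2 = L ^ 2) (hdvd : L ∣ δ) :
    (∃ x : ℕ, (x : ℝ) = 2 * (δ : ℝ) * m * ((m : ℝ) ^ 2 - (n : ℝ) ^ 2) / L) ∧
      (∃ y : ℕ, (y : ℝ) = 4 * (δ : ℝ) * (m : ℝ) ^ 2 * n / L) ∧
      (∃ A : ℕ, (A : ℝ) =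
        (δ : ℝ) ^ 2 * m * n *
          (((m : ℝ) ^ 2 - (n : ℝ) ^ 2) +
            ((m : ℝ) ^ 2 - (n : ℝ) ^ 2) ^ 2 / ((m : ℝ) ^ 2 + (n : ℝ) ^ 2) +
            2 * (m : ℝ) ^ 2)) := by
  obtain ⟨k, rfl⟩ := hdvd
  have hL' : (L : ℝ) ≠ 0 := by positivity
  have hpyth' : (m : ℝ) ^ 2 + (n : ℝ) ^ 2 = (L : ℝ) ^ 2 := by exact_mod_cast hpyth
  obtain ⟨d, hd⟩ := Nat.exists_eq_add_of_le (Nat.pow_le_pow_left hmn.le 2)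
  have hd' : (m : ℝ) ^ 2 - (n : ℝ) ^ 2 = d := by
    rw [sub_eq_iff_eq_add']
    exact_mod_cast hd
  rw [hpyth', hd']
  refine ⟨⟨2 * k * m * d, ?_⟩, ⟨4 * k * m ^ 2 * n, ?_⟩,
    ⟨k ^ 2 * m * n * (L ^ 2 * d + d ^ 2 + 2 * L ^ 2 * m ^ 2), ?_⟩⟩ <;>
  · push_cast
    field_simp
end
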